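/- For every constant C ∈ ℕ there exists c > 0 such that the following holds with δ = 1/10000. Let m ≥ 1 and let S₀,…,S_m be disjoint subsets of ℤ² with #S_j ≤ 2^j. Let j⃗ = (j₁,j₂,j₃,j₄) ∈ {0,…,m}⁴ and a⃗ = (a₁,a₂,a₃,a₄) with 1 ≤ a_k < j_k/2 + C for k = 1,2,3,4. Then #𝒬⁰(j⃗,a⃗) ≤ c · 2^{(j₁+j₂+j₃+j₄)/2 − δ Σ_{k=1}^4 (|j_k − j_{k+1}| + |a_k − a_{k+1}|)}, where indices are taken cyclically mod 4. -/

import Mathlib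

open scoped BigOperators

noncomputable section

/-- Points of the integer lattice `ℤ²`. -/
abbrev Pt := ℤ × ℤ

/-- A quadruple of lattice points, viewed as a function on `Fin 4`
(indices taken cyclically). -/
abbrev Quad := Fin 4 → Pt

/-- The embedding `ℤ² ↪ ℝ²`. -/
def emb (ξ : Pt) : ℝ × ℝ := ((ξ.1 : ℝ), (ξ.2 : ℝ))

/-- An affine line in the plane `ℝ²`. -/
def IsLine (ℓ : Set (ℝ × ℝ)) : Prop :=
  ∃ p v : ℝ × ℝ, v ≠ 0 ∧ ℓ = {x | ∃ t : ℝ, x = p + t • v}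

/-- The line through two lattice points `p ≠ q` (a degenerate point if `p = q`). -/
def lineThrough (p q : Pt) : Set (ℝ × ℝ) :=
  {x | ∃ t : ℝ, x = emb p + t • (emb q - emb p)}

/-- The number of points of a finite set `T ⊂ ℤ²` on a set `ℓ ⊂ ℝ²`,
i.e. `#(ℓ ∩ T)`. -/
def lineCount (ℓ : Set (ℝ × ℝ)) (T : Finset Pt) : ℕ :=
  (ℓ ∩ (emb '' (T : Set Pt))).ncard

/-- `Q = (ξ₁,ξ₂,ξ₃,ξ₄)` is a parallelogram: `ξ₁ + ξ₃ = ξ₂ + ξ₄`. -/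
def IsPara (Q : Quad) : Prop := Q 0 + Q 2 = Q 1 + Q 3

/-- The dot product `(ξ₁ − ξ₂)·(ξ₁ − ξ₄)`. -/
def dotQ (Q : Quad) : ℤ :=
  ((Q 0).1 - (Q 1).1) * ((Q 0).1 - (Q 3).1) + ((Q 0).2 - (Q 1).2) * ((Q 0).2 - (Q 3).2)

/-- `τ_Q = ||ξ₁|² − |ξ₂|² + |ξ₃|² − |ξ₄|²| = 2|(ξ₁−ξ₂)·(ξ₁−ξ₄)|`. -/
def tauQ (Q : Quad) : ℤ := 2 * |dotQ Q|

/-- `Q` is a rectangle: a parallelogram with `τ_Q = 0`. Membership in `𝒬⁰`. -/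
def IsRect (Q : Quad) : Prop := IsPara Q ∧ dotQ Q = 0

/-- `f(Q) = f(ξ₁)f(ξ₂)f(ξ₃)f(ξ₄)`. -/
def fQ (f : Pt → ℝ) (Q : Quad) : ℝ := ∏ k : Fin 4, f (Q k)

/-- The weight `f = ∑_{j=0}^m λ_j 2^{−j/2} χ_{S_j}`. -/
def fWt (S : ℕ → Finset Pt) (lam : ℕ → ℝ) (m : ℕ) (ξ : Pt) : ℝ :=
  ∑ j ∈ Finset.range (m + 1), if ξ ∈ S j then lam j * (2 : ℝ) ^ (-(j : ℝ) / 2) else 0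

/-- `gcd((a,b)) = gcd(|a|,|b|)` for `(a,b) ∈ ℤ²`. -/
def gcdP (ξ : Pt) : ℕ := Int.gcd ξ.1 ξ.2

/-- `max{#(ℓ(ξ,η₁) ∩ S_j), #(ℓ(ξ,η₂) ∩ S_j)}`, where `η₁, η₂` are the two
neighboring vertices of `ξ` in a rectangle. -/
def crossMax (S : ℕ → Finset Pt) (j : ℕ) (ξ η₁ η₂ : Pt) : ℕ :=
  max (lineCount (lineThrough ξ η₁) (S j)) (lineCount (lineThrough ξ η₂) (S j))

/-- `ξ` lies in some `S_j`, `j ≤ m`, and is a vertex of type `α ∈ {1,2,3}`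
relative to its neighbors `η₁, η₂`: with `a := log₂ crossMax`, type 1 means
`a ≥ j/2 + C` (i.e. `crossMax ≥ 2^{j/2+C}`), type 2 means `1 ≤ a < j/2 + C`
(i.e. `2 ≤ crossMax < 2^{j/2+C}`), and type 3 means `a = 0` (`crossMax = 1`). -/
def VertexType (S : ℕ → Finset Pt) (C m : ℕ) (α : ℕ) (ξ η₁ η₂ : Pt) : Prop :=
  ∃ j ≤ m, ξ ∈ S j ∧
    ((α = 1 ∧ (2 : ℝ) ^ ((j : ℝ) / 2 + (C : ℝ)) ≤ (crossMax S j ξ η₁ η₂ : ℝ)) ∨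
     (α = 2 ∧ 2 ≤ crossMax S j ξ η₁ η₂ ∧
        (crossMax S j ξ η₁ η₂ : ℝ) < (2 : ℝ) ^ ((j : ℝ) / 2 + (C : ℝ))) ∨
     (α = 3 ∧ crossMax S j ξ η₁ η₂ = 1))

/-- The set `𝒬⁰_{α,β}`: rectangles with four distinct vertices, all in
`∪_{j=0}^m S_j`, with `ξ₁, ξ₂` of type `α` and `ξ₃, ξ₄` of type `β`. -/
def QZeroAB (S : ℕ → Finset Pt) (C m : ℕ) (α β : ℕ) : Set Quad :=
  {Q | IsRect Q ∧ Function.Injective Q ∧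
    VertexType S C m α (Q 0) (Q 1) (Q 3) ∧
    VertexType S C m α (Q 1) (Q 2) (Q 0) ∧
    VertexType S C m β (Q 2) (Q 3) (Q 1) ∧
    VertexType S C m β (Q 3) (Q 0) (Q 2)}

/-- The set `𝒬⁰(j⃗, a⃗)`: rectangles with distinct vertices `ξ_k ∈ S_{j_k}` such
that for each `k` (cyclically), `2^{a_k} ≤ max{#(ℓ(ξ_k,ξ_{k+1}) ∩ S_{j_k}),
#(ℓ(ξ_k,ξ_{k−1}) ∩ S_{j_k})} < 2^{a_k+1}`. -/
def QZeroJA (S : ℕ → Finset Pt) (j a : Fin 4 → ℕ) : Set Quad :=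
  {Q | IsRect Q ∧ Function.Injective Q ∧ (∀ k, Q k ∈ S (j k)) ∧
    ∀ k : Fin 4,
      2 ^ (a k) ≤ max (lineCount (lineThrough (Q k) (Q (k + 1))) (S (j k)))
          (lineCount (lineThrough (Q k) (Q (k - 1))) (S (j k))) ∧
        max (lineCount (lineThrough (Q k) (Q (k + 1))) (S (j k)))
          (lineCount (lineThrough (Q k) (Q (k - 1))) (S (j k))) < 2 ^ (a k + 1)}

/-- A segment in the plane, given by its left and right endpoints. -/
abbrev Seg := (ℝ × ℝ) × (ℝ × ℝ)

namespace Seg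

/-- The slope of a segment. -/
def slope (e : Seg) : ℝ := (e.2.2 - e.1.2) / (e.2.1 - e.1.1)

/-- The height over `x` of the line spanned by a segment. -/
def height (e : Seg) (x : ℝ) : ℝ := e.1.2 + e.slope * (x - e.1.1)

/-- Two segments cross if their interiors share a point. -/
def Crosses (e f : Seg) : Prop :=
  ∃ x, e.1.1 < x ∧ f.1.1 < x ∧ x < e.2.1 ∧ x < f.2.1 ∧ e.height x = f.height x

/-- The point `w` lies strictly between the segments `e` (below) and `g` (above). -/
def Between (e g : Seg) (w : ℝ × ℝ) : Prop :=
  e.1.1 < w.1 ∧ w.1 < e.2.1 ∧ w.1 < g.2.1 ∧ e.height w.1 < w.2 ∧ w.2 < g.height w.1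

theorem height_left (e : Seg) : e.height e.1.1 = e.1.2 := by simp [height]

theorem height_right {e : Seg} (h : e.1.1 < e.2.1) : e.height e.2.1 = e.2.2 := by
  have : e.2.1 - e.1.1 ≠ 0 := (sub_pos.2 h).ne'
  simp [height, slope, this]

theorem height_eq (e : Seg) (x y : ℝ) : e.height x = e.height y + e.slope * (x - y) := by
  simp only [height]; ring

theorem crosses_of_lt {e f : Seg} {x y : ℝ} (hxy : x < y) (he : e.1.1 ≤ x) (hf : f.1.1 ≤ x)
    (he' : y ≤ e.2.1) (hf' : y ≤ f.2.1) (hx : e.height x < f.height x)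
    (hy : f.height y < e.height y) : Crosses e f := by
  rw [e.height_eq y x, f.height_eq y x] at hy
  set d := f.height x - e.height x
  have hd0 : 0 < d := sub_pos.2 hx
  have hs : 0 < e.slope - f.slope := by
    by_contra hs
    nlinarith [mul_nonneg (not_lt.1 hs |> sub_nonneg.2) (sub_pos.2 hxy).le]
  have h1 : 0 < d / (e.slope - f.slope) := div_pos hd0 hs
  have h2 : d / (e.slope - f.slope) < y - x := by
    rw [div_lt_iff₀ hs]; linarith
  refine ⟨x + d / (e.slope - f.slope), by linarith, by linarith, by linarith, by linarith, ?_⟩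
  rw [e.height_eq _ x, f.height_eq _ x]
  have : (e.slope - f.slope) * (d / (e.slope - f.slope)) = d := by field_simp
  linarith

theorem eq_of_slope_eq {E : Finset Seg} (hE : ∀ e ∈ E, e.1.1 < e.2.1)
    (hX : ∀ e ∈ E, ∀ f ∈ E, e ≠ f → ¬ Crosses e f) {e f : Seg} (he : e ∈ E) (hf : f ∈ E)
    (h : (e.1 = f.1 ∨ e.2 = f.2)) (hs : e.slope = f.slope) : e = f := by
  by_contra hne
  apply hX e he f hf hne
  have h1 := hE e he
  have h2 := hE f hf
  rcases h with h | h
  · have h1' : f.1.1 < e.2.1 := h ▸ h1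
    obtain ⟨x, hx, hx'⟩ := exists_between (lt_min h1' h2)
    rw [lt_min_iff] at hx'
    refine ⟨x, h ▸ hx, hx, hx'.1, hx'.2, ?_⟩
    simp only [height, h, hs]
  · have h1' : e.1.1 < f.2.1 := h ▸ h1
    obtain ⟨x, hx, hx'⟩ := exists_between (max_lt h1' h2)
    rw [max_lt_iff] at hx
    refine ⟨x, hx.1, hx.2, h ▸ hx', hx', ?_⟩
    rw [e.height_eq x e.2.1, f.height_eq x f.2.1, height_right h1, height_right h2, h, hs]

end Seg

open Seg in
/-- A crossing-free straight-line graph has at most linearly many edges. -/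
theorem card_le_of_crossing_free (P : Finset (ℝ × ℝ)) (E : Finset Seg)
    (hP : ∀ e ∈ E, e.1 ∈ P ∧ e.2 ∈ P) (hE : ∀ e ∈ E, e.1.1 < e.2.1)
    (hI : ∀ e ∈ E, ∀ w ∈ P, e.1.1 < w.1 → w.1 < e.2.1 → w.2 ≠ e.height w.1)
    (hX : ∀ e ∈ E, ∀ f ∈ E, e ≠ f → ¬ Crosses e f) : E.card ≤ 4 * P.card := by
  classical
  have hext := fun {e f} => @eq_of_slope_eq E hE hX e f
  have hnext : ∀ e : Seg, ∃ g, (∃ h ∈ E, h.1 = e.1 ∧ e.slope < h.slope) →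
      g ∈ E ∧ g.1 = e.1 ∧ e.slope < g.slope ∧
        ∀ h ∈ E, h.1 = e.1 → e.slope < h.slope → g.slope ≤ h.slope := by
    intro e
    by_cases h : ∃ h ∈ E, h.1 = e.1 ∧ e.slope < h.slope
    · obtain ⟨h, hh, hh'⟩ := h
      obtain ⟨g, hg, hg'⟩ := (E.filter fun h => h.1 = e.1 ∧ e.slope < h.slope).exists_min_image
        Seg.slope ⟨h, by simp [hh, hh']⟩
      simp only [Finset.mem_filter] at hg hg'
      exact ⟨g, fun _ => ⟨hg.1, hg.2.1, hg.2.2, fun k hk hk1 hk2 => hg' k ⟨hk, hk1, hk2⟩⟩⟩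
    · exact ⟨e, fun h' => absurd h' h⟩
  choose next hnext using hnext
  let N := E.filter fun e => ∃ h ∈ E, h.1 = e.1 ∧ e.slope < h.slope
  have hN : ∀ e ∈ N, e ∈ E ∧ next e ∈ E ∧ (next e).1 = e.1 ∧ e.slope < (next e).slope ∧
      ∀ h ∈ E, h.1 = e.1 → e.slope < h.slope → (next e).slope ≤ h.slope := by
    intro e he
    rw [Finset.mem_filter] at he
    exact ⟨he.1, hnext e he.2⟩
  let T := E.filter fun e => ∀ g ∈ E, g.1 = e.1 → g.slope ≤ e.slope
  let B := E.filter fun e => ∀ g ∈ E, g.2 = e.2 → e.slope ≤ g.slope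
  let C := N.filter fun e => ∀ g ∈ E, g.2 = (next e).2 → g.slope ≤ (next e).slope
  let D := N.filter fun e => ∃ w ∈ P, Between e (next e) w
  have hcover : E ⊆ T ∪ B ∪ (C ∪ D) := by
    intro e he
    simp only [Finset.mem_union]
    by_contra hcon
    push Not at hcon
    obtain ⟨⟨hT, hB⟩, hC, hD⟩ := hcon
    have heN : e ∈ N := by
      simp only [T, Finset.mem_filter, not_and, not_forall, not_le] at hT
      obtain ⟨g, h1, h2, h3⟩ := hT he
      exact Finset.mem_filter.2 ⟨he, g, h1, h2, h3⟩
    obtain ⟨-, hgE, hg1, hgs, -⟩ := hN e heN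
    set g := next e
    apply hD
    refine Finset.mem_filter.2 ⟨heN, ?_⟩
    have hee := hE e he
    have hgg := hE g hgE
    have hg11 : g.1.1 = e.1.1 := by rw [hg1]
    have hgx : ∀ x, g.height x - e.height x = (g.slope - e.slope) * (x - e.1.1) := by
      intro x; simp only [height, hg1]; ring
    have hgx' : ∀ x, e.1.1 < x → e.height x < g.height x := by
      intro x hx
      have := hgx x
      nlinarith [mul_pos (sub_pos.2 hgs) (sub_pos.2 hx)]
    rcases le_or_gt e.2.1 g.2.1 with hle | hlt
    · simp only [B, Finset.mem_filter, not_and, not_forall, not_le] at hB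
      obtain ⟨f, hf, hf2, hfs⟩ := hB he
      have hff := hE f hf
      have hf21 : f.2.1 = e.2.1 := by rw [hf2]
      have hfe : ∀ x, x < e.2.1 → e.height x < f.height x := by
        intro x hx
        rw [e.height_eq x e.2.1, f.height_eq x f.2.1, height_right hee, height_right hff, hf2]
        nlinarith [mul_pos (sub_pos.2 hfs) (sub_pos.2 hx)]
      have hfg : f.height e.2.1 < g.height e.2.1 := by
        have := hgx' e.2.1 hee
        rwa [height_right hee, ← hf2, height_right hff |>.symm, hf2] at this
      have hne : g ≠ f := by rintro h; rw [h] at hfg; exact lt_irrefl _ hfg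
      have hncr : ¬ Crosses g f := hX g hgE f hf hne
      have hlt : e.1.1 < f.1.1 := by
        by_contra hcon
        refine hncr (crosses_of_lt (x := e.1.1) (y := e.2.1) hee hg11.le (not_lt.1 hcon) hle
          hf21.ge ?_ hfg)
        have := hfe _ hee
        have h2 := hgx e.1.1
        linarith [height_left e]
      refine ⟨f.1, (hP f hf).1, hlt, by linarith, by linarith, ?_, ?_⟩
      · have := hfe f.1.1 (by linarith)
        rwa [height_left f] at this
      · by_contra hcon
        rcases (not_lt.1 hcon).lt_or_eq with h | h
        · refine hncr (crosses_of_lt (x := f.1.1) (y := e.2.1) (by linarith) (by linarith) le_rfl hle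
            hf21.ge ?_ hfg)
          rwa [height_left f]
        · exact hI g hgE f.1 (hP f hf).1 (by linarith) (by linarith) h.symm
    · have hC' : ¬ ∀ k ∈ E, k.2 = g.2 → k.slope ≤ g.slope := fun h =>
        hC (Finset.mem_filter.2 ⟨heN, h⟩)
      push Not at hC'
      obtain ⟨f, hf, hf2, hfs⟩ := hC'
      have hff := hE f hf
      have hf21 : f.2.1 = g.2.1 := by rw [hf2]
      have hfg : ∀ x, x < g.2.1 → f.height x < g.height x := by
        intro x hx
        rw [g.height_eq x g.2.1, f.height_eq x f.2.1, height_right hgg, height_right hff, hf2]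
        nlinarith [mul_pos (sub_pos.2 hfs) (sub_pos.2 hx)]
      have hfe : e.height g.2.1 < f.height g.2.1 := by
        have := hgx' g.2.1 (by linarith)
        rwa [height_right hgg, ← hf2, height_right hff |>.symm, hf2] at this
      have hne : f ≠ e := by rintro h; rw [h] at hfe; exact lt_irrefl _ hfe
      have hncr : ¬ Crosses f e := hX f hf e he hne
      have hlt : e.1.1 < f.1.1 := by
        by_contra hcon
        refine hncr (crosses_of_lt (x := e.1.1) (y := g.2.1) (by linarith) (not_lt.1 hcon) le_rfl
          hf21.ge (by linarith) ?_ hfe)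
        have := hfg e.1.1 (by linarith)
        have h2 := hgx e.1.1
        linarith [height_left e]
      refine ⟨f.1, (hP f hf).1, hlt, by linarith, by linarith, ?_, ?_⟩
      · by_contra hcon
        rcases (not_lt.1 hcon).lt_or_eq with h | h
        · refine hncr (crosses_of_lt (x := f.1.1) (y := g.2.1) (by linarith) le_rfl (by linarith)
            hf21.ge (by linarith) ?_ hfe)
          rwa [height_left f]
        · exact hI e he f.1 (hP f hf).1 (by linarith) (by linarith) h
      · have := hfg f.1.1 (by linarith)
        rwa [height_left f] at this
  have hTcard : T.card ≤ P.card := by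
    refine Finset.card_le_card_of_injOn Prod.fst (fun e he => ?_) (fun e he f hf h => ?_)
    · exact (hP e (Finset.mem_filter.1 he).1).1
    · obtain ⟨he, he'⟩ := Finset.mem_filter.1 he
      obtain ⟨hf, hf'⟩ := Finset.mem_filter.1 hf
      exact hext he hf (Or.inl h) (le_antisymm (hf' e he h) (he' f hf h.symm))
  have hBcard : B.card ≤ P.card := by
    refine Finset.card_le_card_of_injOn Prod.snd (fun e he => ?_) (fun e he f hf h => ?_)
    · exact (hP e (Finset.mem_filter.1 he).1).2
    · obtain ⟨he, he'⟩ := Finset.mem_filter.1 he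
      obtain ⟨hf, hf'⟩ := Finset.mem_filter.1 hf
      exact hext he hf (Or.inr h) (le_antisymm (he' f hf h.symm) (hf' e he h))
  have hCcard : C.card ≤ P.card := by
    refine Finset.card_le_card_of_injOn (fun e => (next e).2) (fun e he => ?_)
      (fun e he f hf h => ?_)
    · exact (hP _ (hN e (Finset.mem_filter.1 he).1).2.1).2
    · obtain ⟨he, he'⟩ := Finset.mem_filter.1 he
      obtain ⟨hf, hf'⟩ := Finset.mem_filter.1 hf
      obtain ⟨heE, h1, h2, h3, h4⟩ := hN e he
      obtain ⟨hfE, k1, k2, k3, k4⟩ := hN f hf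
      have hn : next e = next f :=
        hext h1 k1 (Or.inr h) (le_antisymm (hf' _ h1 h) (he' _ k1 h.symm))
      have hef : e.1 = f.1 := by rw [← h2, ← k2, hn]
      refine hext heE hfE (Or.inl hef) (le_antisymm ?_ ?_)
      · by_contra hlt
        have := k4 e heE hef (not_le.1 hlt)
        rw [← hn] at this
        linarith
      · by_contra hlt
        have := h4 f hfE hef.symm (not_le.1 hlt)
        rw [hn] at this
        linarith
  have hDcard : D.card ≤ P.card := by
    have hw : ∀ e : Seg, ∃ w, e ∈ D → w ∈ P ∧ Between e (next e) w ∧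
        ∀ u ∈ P, Between e (next e) u → w.1 ≤ u.1 := by
      intro e
      by_cases he : e ∈ D
      · obtain ⟨w, hw, hw'⟩ := (Finset.mem_filter.1 he).2
        obtain ⟨w, hw, hw'⟩ := (P.filter fun w => Between e (next e) w).exists_min_image
          Prod.fst ⟨w, by simp [hw, hw']⟩
        simp only [Finset.mem_filter] at hw hw'
        exact ⟨w, fun _ => ⟨hw.1, hw.2, fun u hu hu' => hw' u ⟨hu, hu'⟩⟩⟩
      · exact ⟨0, fun h => absurd h he⟩
    choose pt hpt using hw
    have key : ∀ e ∈ D, ∀ f ∈ D, pt e = pt f → e.1.1 ≤ f.1.1 → e.1 = f.1 := by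
      intro e he f hf hef hle
      obtain ⟨hw, ⟨b1, b2, b3, b4, b5⟩, hmin⟩ := hpt e he
      obtain ⟨-, ⟨c1, c2, c3, c4, c5⟩, -⟩ := hpt f hf
      rw [← hef] at c1 c2 c3 c4 c5
      obtain ⟨heE, h1, h2, h3, -⟩ := hN e (Finset.mem_filter.1 he).1
      obtain ⟨hfE, k1, k2, k3, -⟩ := hN f (Finset.mem_filter.1 hf).1
      have h21 : (next e).1.1 = e.1.1 := by rw [h2]
      have k21 : (next f).1.1 = f.1.1 := by rw [k2]
      have k22 : (next f).height f.1.1 = f.1.2 := by rw [← k2, height_left]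
      have h22 : (next e).height e.1.1 = e.1.2 := by rw [← h2, height_left]
      by_contra hne
      have hup : f.1.2 ≤ (next e).height f.1.1 := by
        by_contra hcon
        refine hX (next e) h1 f hfE ?_ (crosses_of_lt (x := f.1.1) (y := (pt e).1) c1 (by linarith)
          le_rfl b3.le c2.le (by rw [height_left]; exact not_le.1 hcon) (by linarith))
        rintro h
        exact hne (by rw [← h2, h])
      have hlow : e.height f.1.1 ≤ f.1.2 := by
        by_contra hcon
        refine hX (next f) k1 e heE ?_ (crosses_of_lt (x := f.1.1) (y := (pt e).1) c1 (by linarith)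
          hle c3.le b2.le (by rw [k22]; exact not_le.1 hcon) (by linarith))
        rintro h
        exact hne (by rw [← k2, h])
      rcases hle.lt_or_eq with hlt | heq
      · have hbt : Between e (next e) f.1 := by
          refine ⟨hlt, by linarith, by linarith, lt_of_le_of_ne hlow ?_, lt_of_le_of_ne hup ?_⟩
          · exact (hI e heE f.1 (hP f hfE).1 hlt (by linarith)).symm
          · exact hI _ h1 f.1 (hP f hfE).1 (by linarith) (by linarith)
        have := hmin f.1 (hP f hfE).1 hbt
        linarith
      · rw [← heq] at hup hlow
        rw [height_left] at hlow
        exact hne (Prod.ext heq (by linarith))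
    have key2 : ∀ e ∈ D, ∀ f ∈ D, pt e = pt f → e.1 = f.1 → e.slope ≤ f.slope := by
      intro e he f hf hef h
      obtain ⟨-, ⟨b1, b2, b3, b4, b5⟩, -⟩ := hpt e he
      obtain ⟨-, ⟨c1, c2, c3, c4, c5⟩, -⟩ := hpt f hf
      rw [← hef] at c1 c2 c3 c4 c5
      obtain ⟨heE, -⟩ := hN e (Finset.mem_filter.1 he).1
      obtain ⟨hfE, k1, k2, k3, k4⟩ := hN f (Finset.mem_filter.1 hf).1
      by_contra hlt
      have h5 := k4 e heE h (not_le.1 hlt)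
      have h6 : (next f).height (pt e).1 ≤ e.height (pt e).1 := by
        simp only [height, k2, h]
        nlinarith [mul_nonneg (sub_nonneg.2 h5) (sub_pos.2 c1).le]
      linarith
    refine Finset.card_le_card_of_injOn pt (fun e he => (hpt e he).1) (fun e he f hf h => ?_)
    have hef : e.1 = f.1 := by
      rcases le_total e.1.1 f.1.1 with hle | hle
      · exact key e he f hf h hle
      · exact (key f hf e he h.symm hle).symm
    exact hext (hN e (Finset.mem_filter.1 he).1).1 (hN f (Finset.mem_filter.1 hf).1).1 (Or.inl hef)
      (le_antisymm (key2 e he f hf h hef) (key2 f hf e he h.symm hef.symm))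
  calc E.card ≤ (T ∪ B ∪ (C ∪ D)).card := Finset.card_le_card hcover
    _ ≤ (T ∪ B).card + (C ∪ D).card := Finset.card_union_le _ _
    _ ≤ (T.card + B.card) + (C.card + D.card) :=
        add_le_add (Finset.card_union_le _ _) (Finset.card_union_le _ _)
    _ ≤ 4 * P.card := by omega

open Classical in
/-- The ordered pairs of distinct crossing segments of `E`. -/
def crossingPairs (E : Finset Seg) : Finset (Seg × Seg) :=
  (E ×ˢ E).filter fun x => x.1 ≠ x.2 ∧ x.1.Crosses x.2

theorem mem_crossingPairs {E : Finset Seg} {x : Seg × Seg} :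
    x ∈ crossingPairs E ↔ (x.1 ∈ E ∧ x.2 ∈ E) ∧ x.1 ≠ x.2 ∧ x.1.Crosses x.2 := by
  simp [crossingPairs]

theorem card_le_add_card_crossingPairs (P : Finset (ℝ × ℝ)) (E : Finset Seg)
    (hP : ∀ e ∈ E, e.1 ∈ P ∧ e.2 ∈ P) (hE : ∀ e ∈ E, e.1.1 < e.2.1)
    (hI : ∀ e ∈ E, ∀ w ∈ P, e.1.1 < w.1 → w.1 < e.2.1 → w.2 ≠ e.height w.1) :
    E.card ≤ 4 * P.card + (crossingPairs E).card := by
  classical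
  induction E using Finset.strongInduction with
  | H E ih =>
    by_cases hX : ∀ e ∈ E, ∀ f ∈ E, e ≠ f → ¬ e.Crosses f
    · exact (card_le_of_crossing_free P E hP hE hI hX).trans (Nat.le_add_right _ _)
    · push Not at hX
      obtain ⟨e, he, f, hf, hne, hc⟩ := hX
      have hsub : ∀ {g}, g ∈ E.erase e → g ∈ E := Finset.mem_of_mem_erase
      have h1 := ih (E.erase e) (Finset.erase_ssubset he) (fun g hg => hP g (hsub hg))
        (fun g hg => hE g (hsub hg)) (fun g hg => hI g (hsub hg))
      have h2 : (crossingPairs (E.erase e)).card < (crossingPairs E).card := by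
        refine Finset.card_lt_card (Finset.ssubset_iff_of_subset ?_ |>.2 ⟨(e, f), ?_, ?_⟩)
        · intro x hx
          rw [mem_crossingPairs] at hx ⊢
          exact ⟨⟨hsub hx.1.1, hsub hx.1.2⟩, hx.2⟩
        · exact mem_crossingPairs.2 ⟨⟨he, hf⟩, hne, hc⟩
        · simp [mem_crossingPairs]
      have h3 := Finset.card_erase_add_one he
      omega

/-- A random subset of `P` containing each point with probability `p` contains `T` with
probability `p ^ #T`. -/
theorem sum_powerset_weight {α : Type*} [DecidableEq α] (P T : Finset α) (hT : T ⊆ P) (p : ℝ) :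
    ∑ A ∈ P.powerset, p ^ A.card * (1 - p) ^ (P \ A).card * (if T ⊆ A then 1 else 0) =
      p ^ T.card := by
  have h := Finset.prod_add (fun _ : α => p) (fun x => if x ∈ T then 0 else 1 - p) P
  have hl : ∏ i ∈ P, (p + if i ∈ T then 0 else 1 - p) = p ^ T.card := by
    rw [← Finset.prod_const, ← Finset.prod_subset hT]
    · exact Finset.prod_congr rfl fun x hx => by simp [hx]
    · intro x _ hx; simp [hx]
  rw [← hl, h]
  refine Finset.sum_congr rfl fun A hA => ?_
  rw [Finset.prod_const, mul_assoc]
  congr 1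
  split_ifs with hTA
  · rw [mul_one, ← Finset.prod_const]
    refine Finset.prod_congr rfl fun x hx => ?_
    rw [if_neg fun hx' => (Finset.mem_sdiff.1 hx).2 (hTA hx')]
  · obtain ⟨x, hx, hxA⟩ := Finset.not_subset.1 hTA
    rw [mul_zero]
    exact (Finset.prod_eq_zero (Finset.mem_sdiff.2 ⟨hT hx, hxA⟩) (by simp [hx])).symm

/-- The expected number of members of a family of `n`-sets lying in a random subset of `P`. -/
theorem sum_powerset_weight_mul_card {α β : Type*} [DecidableEq α] (P : Finset α) (F : Finset β)
    (u : β → Finset α) (n : ℕ) (hu : ∀ e ∈ F, u e ⊆ P ∧ (u e).card = n) (p : ℝ) :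
    ∑ A ∈ P.powerset, p ^ A.card * (1 - p) ^ (P \ A).card *
      ((F.filter fun e => u e ⊆ A).card : ℝ) = F.card * p ^ n := by
  simp_rw [Finset.card_filter, Nat.cast_sum, Finset.mul_sum]
  rw [Finset.sum_comm, ← nsmul_eq_mul, ← Finset.sum_const]
  refine Finset.sum_congr rfl fun e he => ?_
  rw [← (hu e he).2, ← sum_powerset_weight P (u e) (hu e he).1 p]
  exact Finset.sum_congr rfl fun A _ => by simp

/-- Averaging a linear inequality between set systems over random subsets of the ground set. -/
theorem card_mul_pow_le_of_sampling {α β γ : Type*} [DecidableEq α] (P : Finset α)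
    (E : Finset β) (X : Finset γ)
    (s : β → Finset α) (t : γ → Finset α) (c b d : ℕ)
    (hs : ∀ e ∈ E, s e ⊆ P ∧ (s e).card = b) (ht : ∀ x ∈ X, t x ⊆ P ∧ (t x).card = d)
    (h : ∀ A ⊆ P, (E.filter fun e => s e ⊆ A).card ≤
      c * A.card + (X.filter fun x => t x ⊆ A).card)
    {p : ℝ} (hp0 : 0 ≤ p) (hp1 : p ≤ 1) :
    (E.card : ℝ) * p ^ b ≤ c * (P.card * p) + X.card * p ^ d := by
  have hcard : ∀ A ∈ P.powerset,
      ((P.filter fun x => {x} ⊆ A).card : ℝ) = A.card := by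
    intro A hA
    congr 2
    ext x
    simpa using fun hx => Finset.mem_powerset.1 hA hx
  have hP := sum_powerset_weight_mul_card P P (fun x => {x}) 1 (by simp) p
  rw [← sum_powerset_weight_mul_card P E s b hs, ← sum_powerset_weight_mul_card P X t d ht,
    ← pow_one p, ← hP, pow_one, Finset.mul_sum, ← Finset.sum_add_distrib]
  refine Finset.sum_le_sum fun A hA => ?_
  rw [hcard A hA]
  have h1 : ((E.filter fun e => s e ⊆ A).card : ℝ) ≤
      c * A.card + (X.filter fun x => t x ⊆ A).card := by
    exact_mod_cast h A (Finset.mem_powerset.1 hA)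
  have h2 : 0 ≤ p ^ A.card * (1 - p) ^ (P \ A).card :=
    mul_nonneg (pow_nonneg hp0 _) (pow_nonneg (sub_nonneg.2 hp1) _)
  nlinarith [mul_le_mul_of_nonneg_left h1 h2]

/-- Incidence of a point with the line `y = ℓ.1 * x + ℓ.2`. -/
def OnLine (ℓ w : ℝ × ℝ) : Prop := w.2 = ℓ.1 * w.1 + ℓ.2

open Classical in
/-- The segments joining consecutive points of `P` on the lines of `L`. -/
def lineSegments (P L : Finset (ℝ × ℝ)) : Finset Seg :=
  (P ×ˢ P).filter fun e => e.1.1 < e.2.1 ∧ (∃ ℓ ∈ L, OnLine ℓ e.1 ∧ OnLine ℓ e.2) ∧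
    ∀ w ∈ P, e.1.1 < w.1 → w.1 < e.2.1 → w.2 ≠ e.height w.1

theorem mem_lineSegments {P L : Finset (ℝ × ℝ)} {e : Seg} :
    e ∈ lineSegments P L ↔ (e.1 ∈ P ∧ e.2 ∈ P) ∧ e.1.1 < e.2.1 ∧
      (∃ ℓ ∈ L, OnLine ℓ e.1 ∧ OnLine ℓ e.2) ∧
      ∀ w ∈ P, e.1.1 < w.1 → w.1 < e.2.1 → w.2 ≠ e.height w.1 := by
  simp [lineSegments]

theorem Seg.height_of_onLine {ℓ : ℝ × ℝ} {e : Seg} (h : e.1.1 < e.2.1) (h1 : OnLine ℓ e.1)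
    (h2 : OnLine ℓ e.2) (x : ℝ) : e.height x = ℓ.1 * x + ℓ.2 := by
  have h0 : e.2.1 - e.1.1 ≠ 0 := (sub_pos.2 h).ne'
  have hs : e.slope = ℓ.1 := by
    rw [Seg.slope, div_eq_iff h0, h1, h2]; ring
  rw [Seg.height, hs, h1]; ring

theorem OnLine.eq_of_fst_eq {ℓ p q : ℝ × ℝ} (hp : OnLine ℓ p) (hq : OnLine ℓ q)
    (h : p.1 = q.1) : p = q :=
  Prod.ext h (by rw [hp, hq, h])

theorem line_eq_of_agree {ℓ k : ℝ × ℝ} {x y : ℝ} (hxy : x ≠ y)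
    (hx : ℓ.1 * x + ℓ.2 = k.1 * x + k.2) (hy : ℓ.1 * y + ℓ.2 = k.1 * y + k.2) : ℓ = k := by
  have h1 : ℓ.1 = k.1 := by
    have : (ℓ.1 - k.1) * (x - y) = 0 := by linarith
    rcases mul_eq_zero.1 this with h | h
    · linarith
    · exact absurd (sub_eq_zero.1 h) hxy
  exact Prod.ext h1 (by rw [h1] at hx; linarith)

/-- Segments between consecutive points of a common line do not overlap. -/
theorem eq_of_mem_lineSegments {P L : Finset (ℝ × ℝ)} {ℓ : ℝ × ℝ} {e f : Seg} {x : ℝ}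
    (he : e ∈ lineSegments P L) (hf : f ∈ lineSegments P L)
    (he1 : OnLine ℓ e.1) (he2 : OnLine ℓ e.2) (hf1 : OnLine ℓ f.1) (hf2 : OnLine ℓ f.2)
    (h1 : e.1.1 < x) (h2 : x < e.2.1) (h3 : f.1.1 < x) (h4 : x < f.2.1) : e = f := by
  obtain ⟨⟨a1, a2⟩, a3, -, a5⟩ := mem_lineSegments.1 he
  obtain ⟨⟨b1, b2⟩, b3, -, b5⟩ := mem_lineSegments.1 hf
  have hE := Seg.height_of_onLine a3 he1 he2
  have hF := Seg.height_of_onLine b3 hf1 hf2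
  refine Prod.ext (he1.eq_of_fst_eq hf1 ?_) (he2.eq_of_fst_eq hf2 ?_)
  · rcases lt_trichotomy e.1.1 f.1.1 with h | h | h
    · exact absurd (hf1.trans (hE _).symm) (a5 _ b1 h (by linarith))
    · exact h
    · exact absurd (he1.trans (hF _).symm) (b5 _ a1 h (by linarith))
  · rcases lt_trichotomy e.2.1 f.2.1 with h | h | h
    · exact absurd (he2.trans (hF _).symm) (b5 _ a2 (by linarith) h)
    · exact h
    · exact absurd (hf2.trans (hE _).symm) (a5 _ b2 (by linarith) h)

/-- Crossing segments lie on different lines, which meet at the crossing point. -/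
theorem exists_lines_of_mem_crossingPairs {P L : Finset (ℝ × ℝ)} {z : Seg × Seg}
    (hz : z ∈ crossingPairs (lineSegments P L)) :
    ∃ ℓ ∈ L, ∃ k ∈ L, ∃ x, ℓ ≠ k ∧ (OnLine ℓ z.1.1 ∧ OnLine ℓ z.1.2) ∧
      (OnLine k z.2.1 ∧ OnLine k z.2.2) ∧ (z.1.1.1 < x ∧ x < z.1.2.1) ∧
      (z.2.1.1 < x ∧ x < z.2.2.1) ∧ ℓ.1 * x + ℓ.2 = k.1 * x + k.2 := by
  obtain ⟨⟨he, hf⟩, hne, x, h1, h2, h3, h4, h5⟩ := mem_crossingPairs.1 hz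
  obtain ⟨-, a3, ⟨ℓ, hℓ, a4, a5⟩, -⟩ := mem_lineSegments.1 he
  obtain ⟨-, b3, ⟨k, hk, b4, b5⟩, -⟩ := mem_lineSegments.1 hf
  refine ⟨ℓ, hℓ, k, hk, x, ?_, ⟨a4, a5⟩, ⟨b4, b5⟩, ⟨h1, h3⟩, ⟨h2, h4⟩, ?_⟩
  · rintro rfl
    exact hne (eq_of_mem_lineSegments he hf a4 a5 b4 b5 h1 h3 h2 h4)
  · rw [← Seg.height_of_onLine a3 a4 a5, ← Seg.height_of_onLine b3 b4 b5, h5]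

theorem card_crossingPairs_lineSegments_le (P L : Finset (ℝ × ℝ)) :
    (crossingPairs (lineSegments P L)).card ≤ L.card ^ 2 := by
  classical
  have h : ∀ z : Seg × Seg, ∃ m : (ℝ × ℝ) × (ℝ × ℝ),
      z ∈ crossingPairs (lineSegments P L) → m.1 ∈ L ∧ m.2 ∈ L ∧ ∃ x, m.1 ≠ m.2 ∧
        (OnLine m.1 z.1.1 ∧ OnLine m.1 z.1.2) ∧ (OnLine m.2 z.2.1 ∧ OnLine m.2 z.2.2) ∧
        (z.1.1.1 < x ∧ x < z.1.2.1) ∧ (z.2.1.1 < x ∧ x < z.2.2.1) ∧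
        m.1.1 * x + m.1.2 = m.2.1 * x + m.2.2 := by
    intro z
    by_cases hz : z ∈ crossingPairs (lineSegments P L)
    · obtain ⟨ℓ, hℓ, k, hk, hx⟩ := exists_lines_of_mem_crossingPairs hz
      exact ⟨(ℓ, k), fun _ => ⟨hℓ, hk, hx⟩⟩
    · exact ⟨0, fun h => absurd h hz⟩
  choose m hm using h
  rw [pow_two, ← Finset.card_product]
  refine Finset.card_le_card_of_injOn m (fun z hz => ?_) (fun z hz w hw hzw => ?_)
  · exact Finset.mem_product.2 ⟨(hm z hz).1, (hm z hz).2.1⟩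
  · obtain ⟨-, -, x, hne, ⟨a1, a2⟩, ⟨a3, a4⟩, ⟨a5, a6⟩, ⟨a7, a8⟩, a9⟩ := hm z hz
    obtain ⟨-, -, y, -, ⟨b1, b2⟩, ⟨b3, b4⟩, ⟨b5, b6⟩, ⟨b7, b8⟩, b9⟩ := hm w hw
    rw [← hzw] at b1 b2 b3 b4 b9
    have hxy : x = y := by
      by_contra hxy
      exact hne (line_eq_of_agree hxy a9 b9)
    subst hxy
    obtain ⟨⟨he, hf⟩, -⟩ := mem_crossingPairs.1 (Finset.mem_coe.1 hz)
    obtain ⟨⟨he', hf'⟩, -⟩ := mem_crossingPairs.1 (Finset.mem_coe.1 hw)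
    exact Prod.ext (eq_of_mem_lineSegments he he' a1 a2 b1 b2 a5 a6 b5 b6)
      (eq_of_mem_lineSegments hf hf' a3 a4 b3 b4 a7 a8 b7 b8)

open Classical in
theorem card_endpoints_of_mem_crossingPairs {P L : Finset (ℝ × ℝ)} {z : Seg × Seg}
    (hz : z ∈ crossingPairs (lineSegments P L)) :
    ({z.1.1, z.1.2, z.2.1, z.2.2} : Finset (ℝ × ℝ)).card = 4 := by
  obtain ⟨ℓ, -, k, -, x, hne, ⟨a1, a2⟩, ⟨a3, a4⟩, ⟨a5, a6⟩, ⟨a7, a8⟩, a9⟩ :=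
    exists_lines_of_mem_crossingPairs hz
  have key : ∀ u v : ℝ × ℝ, OnLine ℓ u → OnLine k v → u.1 ≠ x → u ≠ v := by
    rintro u v hu hv hx rfl
    exact hne (line_eq_of_agree hx (hu.symm.trans hv) a9)
  have h1 : z.1.1 ≠ z.1.2 := fun h => by rw [h] at a5; linarith
  have h2 : z.2.1 ≠ z.2.2 := fun h => by rw [h] at a7; linarith
  simp [Finset.card_insert_of_notMem, h1, h2, key _ _ a1 a3 a5.ne, key _ _ a1 a4 a5.ne,
    key _ _ a2 a3 a6.ne', key _ _ a2 a4 a6.ne']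

open Classical in
/-- A line with at least `r` points of `P` carries at least `r - 1` segments. -/
theorem card_mul_le_card_lineSegments (P L : Finset (ℝ × ℝ)) (r : ℕ)
    (hL : ∀ ℓ ∈ L, r ≤ (P.filter (OnLine ℓ)).card) :
    L.card * (r - 1) ≤ (lineSegments P L).card := by
  set F : ℝ × ℝ → Finset Seg := fun ℓ =>
    (lineSegments P L).filter fun e => OnLine ℓ e.1 ∧ OnLine ℓ e.2 with hF
  have hdisj : (L : Set (ℝ × ℝ)).PairwiseDisjoint F := by
    intro ℓ _ k _ hne
    rw [Function.onFun, Finset.disjoint_left]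
    intro e he he'
    obtain ⟨hE, h1, h2⟩ := Finset.mem_filter.1 he
    obtain ⟨-, h3, h4⟩ := Finset.mem_filter.1 he'
    obtain ⟨-, hlt, -⟩ := mem_lineSegments.1 hE
    exact hne (line_eq_of_agree hlt.ne (h1.symm.trans h3) (h2.symm.trans h4))
  have hcard : ∀ ℓ ∈ L, r - 1 ≤ (F ℓ).card := by
    intro ℓ hℓ
    rcases (P.filter (OnLine ℓ)).eq_empty_or_nonempty with h0 | h0
    · have := hL ℓ hℓ
      rw [h0, Finset.card_empty] at this
      omega
    obtain ⟨t, ht, htmax⟩ := (P.filter (OnLine ℓ)).exists_max_image Prod.fst h0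
    have hsub : (P.filter (OnLine ℓ)).erase t ⊆ (F ℓ).image Prod.fst := by
      intro w hw
      obtain ⟨hwt, hw⟩ := Finset.mem_erase.1 hw
      have hwlt : w.1 < t.1 := lt_of_le_of_ne (htmax w hw) fun h =>
        hwt ((Finset.mem_filter.1 hw).2.eq_of_fst_eq (Finset.mem_filter.1 ht).2 h)
      obtain ⟨v, hv, hvmin⟩ := ((P.filter (OnLine ℓ)).filter fun v => w.1 < v.1).exists_min_image
        Prod.fst ⟨t, Finset.mem_filter.2 ⟨ht, hwlt⟩⟩
      simp only [Finset.mem_filter] at hv hw hvmin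
      have hh := Seg.height_of_onLine (e := (w, v)) hv.2 hw.2 hv.1.2
      refine Finset.mem_image.2 ⟨(w, v), Finset.mem_filter.2 ⟨mem_lineSegments.2
        ⟨⟨hw.1, hv.1.1⟩, hv.2, ⟨ℓ, hℓ, hw.2, hv.1.2⟩, ?_⟩, hw.2, hv.1.2⟩, rfl⟩
      intro u hu h1 h2 h3
      exact absurd (hvmin u ⟨⟨hu, h3.trans (hh _)⟩, h1⟩) (not_le.2 h2)
    calc r - 1 ≤ (P.filter (OnLine ℓ)).card - 1 := Nat.sub_le_sub_right (hL ℓ hℓ) 1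
      _ = ((P.filter (OnLine ℓ)).erase t).card := (Finset.card_erase_of_mem ht).symm
      _ ≤ ((F ℓ).image Prod.fst).card := Finset.card_le_card hsub
      _ ≤ (F ℓ).card := Finset.card_image_le
  calc L.card * (r - 1) = ∑ _ℓ ∈ L, (r - 1) := by simp
    _ ≤ ∑ ℓ ∈ L, (F ℓ).card := Finset.sum_le_sum hcard
    _ = (L.biUnion F).card := (Finset.card_biUnion hdisj).symm
    _ ≤ (lineSegments P L).card := Finset.card_le_card (Finset.biUnion_subset.2 fun ℓ _ =>
        Finset.filter_subset _ _)

/-- The crossing number inequality for the segments cut out on a family of lines. -/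
theorem card_lineSegments_mul_sq_le (P L : Finset (ℝ × ℝ)) {p : ℝ} (hp0 : 0 ≤ p) (hp1 : p ≤ 1) :
    ((lineSegments P L).card : ℝ) * p ^ 2 ≤ 4 * (P.card * p) + (L.card : ℝ) ^ 2 * p ^ 4 := by
  classical
  have h := card_mul_pow_le_of_sampling P (lineSegments P L) (crossingPairs (lineSegments P L))
    (fun e => {e.1, e.2}) (fun z => {z.1.1, z.1.2, z.2.1, z.2.2}) 4 2 4 ?_ ?_ ?_ hp0 hp1
  · have hX : ((crossingPairs (lineSegments P L)).card : ℝ) ≤ (L.card : ℝ) ^ 2 := by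
      exact_mod_cast card_crossingPairs_lineSegments_le P L
    have := mul_le_mul_of_nonneg_right hX (pow_nonneg hp0 4)
    push_cast at h
    linarith
  · intro e he
    obtain ⟨⟨h1, h2⟩, hlt, -⟩ := mem_lineSegments.1 he
    refine ⟨by simp [Finset.insert_subset_iff, h1, h2], Finset.card_pair ?_⟩
    rintro h
    rw [h] at hlt
    exact lt_irrefl _ hlt
  · intro z hz
    refine ⟨?_, card_endpoints_of_mem_crossingPairs hz⟩
    obtain ⟨⟨he, hf⟩, -⟩ := mem_crossingPairs.1 hz
    obtain ⟨⟨h1, h2⟩, -⟩ := mem_lineSegments.1 he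
    obtain ⟨⟨h3, h4⟩, -⟩ := mem_lineSegments.1 hf
    simp [Finset.insert_subset_iff, h1, h2, h3, h4]
  · intro A hA
    set E := (lineSegments P L).filter fun e => ({e.1, e.2} : Finset (ℝ × ℝ)) ⊆ A with hE
    have hmem : ∀ e ∈ E, e ∈ lineSegments P L ∧ e.1 ∈ A ∧ e.2 ∈ A := by
      intro e he
      simpa [hE, Finset.insert_subset_iff] using he
    refine (Finset.card_le_card (t := E) fun e he => by simpa [hE] using he).trans ?_
    refine (card_le_add_card_crossingPairs A E (fun e he => (hmem e he).2)
      (fun e he => (mem_lineSegments.1 (hmem e he).1).2.1)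
      (fun e he w hw => (mem_lineSegments.1 (hmem e he).1).2.2.2 w (hA hw))).trans ?_
    refine Nat.add_le_add_left (Finset.card_le_card fun z hz => ?_) _
    obtain ⟨⟨he, hf⟩, hz'⟩ := mem_crossingPairs.1 hz
    obtain ⟨h1, h2, h3⟩ := hmem _ he
    obtain ⟨h4, h5, h6⟩ := hmem _ hf
    rw [Finset.mem_filter]
    refine ⟨mem_crossingPairs.2 ⟨⟨h1, h4⟩, hz'⟩, ?_⟩
    simp [Finset.insert_subset_iff, h2, h3, h5, h6]

open Classical in
/-- **Szemerédi–Trotter theorem**, for the number of `r`-rich lines of a set of at most `N` points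
in the range `r ^ 2 ≤ K * N`. -/
theorem card_rich_lines_mul_le (P L : Finset (ℝ × ℝ)) (r : ℕ) (hr : 2 ≤ r)
    (hL : ∀ ℓ ∈ L, r ≤ (P.filter (OnLine ℓ)).card) {N K : ℝ} (hN : 0 < N) (hP : P.card ≤ N)
    (hrN : (r : ℝ) ^ 2 ≤ K * N) :
    (L.card : ℝ) * r ^ 3 ≤ (1024 + 16 * K) * N ^ 2 := by
  set l : ℝ := (L.card : ℝ) with hl
  set e : ℝ := ((lineSegments P L).card : ℝ) with he
  have hl0 : 0 ≤ l := Nat.cast_nonneg _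
  have hr2 : (2 : ℝ) ≤ r := by exact_mod_cast hr
  have hel : l * r ≤ 2 * e := by
    have h : (L.card : ℝ) * ((r - 1 : ℕ) : ℝ) ≤ (lineSegments P L).card := by
      exact_mod_cast card_mul_le_card_lineSegments P L r hL
    rw [Nat.cast_sub (by omega)] at h
    push_cast at h
    nlinarith
  have hK : 0 ≤ K := by
    by_contra hK
    nlinarith [mul_pos (neg_pos.2 (not_le.1 hK)) hN]
  rcases lt_or_ge e (8 * N) with hlt | hge
  · have h1 : l * r ≤ 16 * N := by linarith
    calc l * r ^ 3 = l * r * r ^ 2 := by ring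
      _ ≤ 16 * N * (K * N) := by gcongr
      _ ≤ (1024 + 16 * K) * N ^ 2 := by nlinarith [sq_nonneg N]
  · have he0 : 0 < e := by linarith
    have h := card_lineSegments_mul_sq_le P L (p := 8 * N / e) (by positivity)
      ((div_le_one he0).2 hge)
    rw [← hl, ← he] at h
    have h2 : e * (8 * N / e) ^ 2 ≤ 4 * (N * (8 * N / e)) + l ^ 2 * (8 * N / e) ^ 4 := by
      refine h.trans ?_
      gcongr
    have h3 : e ^ 3 ≤ 128 * l ^ 2 * N ^ 2 := by
      have e1 : e * (8 * N / e) ^ 2 = N ^ 2 / e ^ 4 * (64 * e ^ 3) := by field_simp; norm_num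
      have e2 : 4 * (N * (8 * N / e)) + l ^ 2 * (8 * N / e) ^ 4 =
          N ^ 2 / e ^ 4 * (32 * e ^ 3 + 4096 * l ^ 2 * N ^ 2) := by field_simp; ring
      rw [e1, e2] at h2
      have := le_of_mul_le_mul_left h2 (by positivity)
      linarith
    have h4 : (l * r) ^ 3 ≤ (2 * e) ^ 3 := pow_le_pow_left₀ (by positivity) hel 3
    have h5 : l ^ 2 * (l * r ^ 3) ≤ l ^ 2 * (1024 * N ^ 2) := by nlinarith
    rcases hl0.eq_or_lt with h0 | h0
    · rw [← h0, zero_mul]; positivity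
    · have := le_of_mul_le_mul_left h5 (by positivity)
      nlinarith [mul_nonneg hK (sq_nonneg N)]

/-- Twice the signed area of the lattice triangle `p q r`. -/
def crossProd (p q r : Pt) : ℤ := (q.1 - p.1) * (r.2 - p.2) - (q.2 - p.2) * (r.1 - p.1)

theorem crossProd_self_right (p q : Pt) : crossProd p q q = 0 := by
  simp only [crossProd]; ring

theorem crossProd_self_left (p q : Pt) : crossProd p q p = 0 := by
  simp only [crossProd]; ring

theorem emb_mem_lineThrough {p q : Pt} (h : p ≠ q) (r : Pt) :
    emb r ∈ lineThrough p q ↔ crossProd p q r = 0 := by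
  have hcast : crossProd p q r = 0 ↔
      ((q.1 : ℝ) - p.1) * (r.2 - p.2) - (q.2 - p.2) * (r.1 - p.1) = 0 := by
    rw [← Int.cast_inj (α := ℝ)]; simp [crossProd]
  rw [hcast]
  simp only [lineThrough, emb, Set.mem_ofPred_eq, Prod.ext_iff, Prod.fst_add, Prod.snd_add,
    Prod.smul_fst, Prod.smul_snd, Prod.fst_sub, Prod.snd_sub, smul_eq_mul]
  constructor
  · rintro ⟨t, h1, h2⟩
    rw [h1, h2]; ring
  · intro h0
    by_cases h1 : (q.1 : ℝ) - p.1 = 0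
    · have h2 : (q.2 : ℝ) - p.2 ≠ 0 := by
        intro h2
        rw [sub_eq_zero, Int.cast_inj] at h1 h2
        exact h (Prod.ext h1.symm h2.symm)
      refine ⟨((r.2 : ℝ) - p.2) / (q.2 - p.2), ?_, ?_⟩
      · rw [h1, zero_mul, zero_sub, neg_eq_zero, mul_eq_zero] at h0
        rw [h1]
        linarith [h0.resolve_left h2]
      · rw [div_mul_cancel₀ _ h2]; ring
    · refine ⟨((r.1 : ℝ) - p.1) / (q.1 - p.1), ?_, ?_⟩
      · rw [div_mul_cancel₀ _ h1]; ring
      · field_simp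
        linarith

theorem emb_injective : Function.Injective emb := by
  intro p q h
  simpa [emb, Prod.ext_iff] using h

theorem lineCount_lineThrough {p q : Pt} (h : p ≠ q) (T : Finset Pt) :
    lineCount (lineThrough p q) T = (T.filter fun r => crossProd p q r = 0).card := by
  have : lineThrough p q ∩ emb '' (T : Set Pt) =
      emb '' ((T.filter fun r => crossProd p q r = 0 : Finset Pt) : Set Pt) := by
    ext x
    constructor
    · rintro ⟨hx, r, hr, rfl⟩
      exact ⟨r, Finset.mem_coe.2 (Finset.mem_filter.2 ⟨hr, (emb_mem_lineThrough h r).1 hx⟩), rfl⟩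
    · rintro ⟨r, hr, rfl⟩
      rw [Finset.mem_coe, Finset.mem_filter] at hr
      exact ⟨(emb_mem_lineThrough h r).2 hr.2, r, hr.1, rfl⟩
  rw [lineCount, this, Set.ncard_image_of_injective _ emb_injective, Set.ncard_coe_finset]

/-- An irrational shear: a linear embedding of `ℤ²` in the plane that maps no lattice line to a
vertical line. -/
def shear (p : Pt) : ℝ × ℝ := (p.1 + √2 * p.2, p.2)

theorem shear_fst_injective : Function.Injective fun p => (shear p).1 := by
  intro p q h
  simp only [shear] at h
  have h0 : ((p.1 - q.1 : ℤ) : ℝ) + √2 * ((p.2 - q.2 : ℤ) : ℝ) = 0 := by push_cast; linarith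
  have h2 : p.2 - q.2 = 0 := by
    by_contra hne
    refine (irrational_sqrt_two.mul_intCast hne).ne_int (-(p.1 - q.1)) ?_
    rw [Int.cast_neg]; linarith
  rw [h2, Int.cast_zero, mul_zero, add_zero, Int.cast_eq_zero] at h0
  exact Prod.ext (sub_eq_zero.1 h0) (sub_eq_zero.1 h2)

theorem shear_injective : Function.Injective shear := fun _ _ h =>
  shear_fst_injective (congrArg Prod.fst h)

/-- The slope and intercept of the sheared line through two lattice points. -/
def shearLine (p q : Pt) : ℝ × ℝ :=
  (((q.2 : ℝ) - p.2) / ((shear q).1 - (shear p).1),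
    p.2 - ((q.2 : ℝ) - p.2) / ((shear q).1 - (shear p).1) * (shear p).1)

theorem onLine_shearLine {p q : Pt} (h : p ≠ q) (r : Pt) :
    OnLine (shearLine p q) (shear r) ↔ crossProd p q r = 0 := by
  have h0 : (shear q).1 - (shear p).1 ≠ 0 := fun h' =>
    h (shear_fst_injective (sub_eq_zero.1 h').symm)
  have hcast : crossProd p q r = 0 ↔
      ((r.2 : ℝ) - p.2) * ((shear q).1 - (shear p).1) =
        ((q.2 : ℝ) - p.2) * ((shear r).1 - (shear p).1) := by
    rw [← Int.cast_inj (α := ℝ), ← sub_eq_zero (b := ((q.2 : ℝ) - p.2) * _)]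
    simp only [crossProd, shear]
    push_cast
    ring_nf
  rw [hcast, ← eq_div_iff h0]
  simp only [OnLine, shearLine]
  have : ((q.2 : ℝ) - p.2) * ((shear r).1 - (shear p).1) / ((shear q).1 - (shear p).1) =
      (q.2 - p.2) / ((shear q).1 - (shear p).1) * (shear r).1 -
        (q.2 - p.2) / ((shear q).1 - (shear p).1) * (shear p).1 := by ring
  rw [this]
  change (r.2 : ℝ) = _ ↔ _
  constructor <;> intro h <;> linarith

open Classical in
/-- Szemerédi–Trotter bound for the incidences of lattice points with lines containing about `r`
of them. -/
theorem card_rich_incidences_mul_le (T : Finset Pt) (I : Finset (Pt × (ℝ × ℝ))) (r : ℕ)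
    (hr : 2 ≤ r) (hI : ∀ x ∈ I, x.1 ∈ T ∧ OnLine x.2 (shear x.1) ∧
      r ≤ (T.filter fun p => OnLine x.2 (shear p)).card ∧
      (T.filter fun p => OnLine x.2 (shear p)).card < 2 * r)
    {N K : ℝ} (hN : 0 < N) (hT : T.card ≤ N) (hrN : (r : ℝ) ^ 2 ≤ K * N) :
    (I.card : ℝ) * r ^ 2 ≤ 2 * (1024 + 16 * K) * N ^ 2 := by
  have hfib : I.card ≤ 2 * r * (I.image Prod.snd).card := by
    refine Finset.card_le_mul_card_image I _ fun ℓ hℓ => ?_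
    obtain ⟨x, hx, rfl⟩ := Finset.mem_image.1 hℓ
    refine le_trans ?_ (hI x hx).2.2.2.le
    refine Finset.card_le_card_of_injOn Prod.fst (fun y hy => ?_) (fun y hy z hz h => ?_)
    · obtain ⟨hy, hyx⟩ := Finset.mem_filter.1 hy
      exact Finset.mem_filter.2 ⟨(hI y hy).1, hyx ▸ (hI y hy).2.1⟩
    · exact Prod.ext h ((Finset.mem_filter.1 hy).2.trans (Finset.mem_filter.1 hz).2.symm)
  have hST := card_rich_lines_mul_le (T.image shear) (I.image Prod.snd) r hr (fun ℓ hℓ => ?_) hN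
    (by rwa [Finset.card_image_of_injective _ shear_injective]) hrN
  · have hfib' : (I.card : ℝ) ≤ 2 * r * ((I.image Prod.snd).card : ℝ) := by exact_mod_cast hfib
    have := mul_le_mul_of_nonneg_right hfib' (sq_nonneg (r : ℝ))
    nlinarith
  · obtain ⟨x, hx, rfl⟩ := Finset.mem_image.1 hℓ
    rw [Finset.filter_image, Finset.card_image_of_injective _ shear_injective]
    exact (hI x hx).2.2.1

/-- The relations of a rectangle, seen from its `k`-th vertex. -/
theorem IsRect.at_vertex {Q : Quad} (h : IsRect Q) (k : Fin 4) :
    Q (k + 2) + Q k = Q (k + 1) + Q (k - 1) ∧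
      ((Q (k + 1)).1 - (Q k).1) * ((Q (k - 1)).1 - (Q k).1) +
        ((Q (k + 1)).2 - (Q k).2) * ((Q (k - 1)).2 - (Q k).2) = 0 := by
  obtain ⟨hp, hd⟩ := h
  simp only [IsPara, dotQ, Prod.ext_iff, Prod.fst_add, Prod.snd_add] at hp hd ⊢
  obtain ⟨h1, h2⟩ := hp
  have e1 : (Q 2).1 = (Q 1).1 + (Q 3).1 - (Q 0).1 := by linarith
  have e2 : (Q 2).2 = (Q 1).2 + (Q 3).2 - (Q 0).2 := by linarith
  fin_cases k
  · change ((Q 2).1 + (Q 0).1 = (Q 1).1 + (Q 3).1 ∧ (Q 2).2 + (Q 0).2 = (Q 1).2 + (Q 3).2) ∧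
      ((Q 1).1 - (Q 0).1) * ((Q 3).1 - (Q 0).1) + ((Q 1).2 - (Q 0).2) * ((Q 3).2 - (Q 0).2) = 0
    rw [e1, e2]
    exact ⟨⟨by ring, by ring⟩, by linear_combination hd⟩
  · change ((Q 3).1 + (Q 1).1 = (Q 2).1 + (Q 0).1 ∧ (Q 3).2 + (Q 1).2 = (Q 2).2 + (Q 0).2) ∧
      ((Q 2).1 - (Q 1).1) * ((Q 0).1 - (Q 1).1) + ((Q 2).2 - (Q 1).2) * ((Q 0).2 - (Q 1).2) = 0
    rw [e1, e2]
    exact ⟨⟨by ring, by ring⟩, by linear_combination -hd⟩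
  · change ((Q 0).1 + (Q 2).1 = (Q 3).1 + (Q 1).1 ∧ (Q 0).2 + (Q 2).2 = (Q 3).2 + (Q 1).2) ∧
      ((Q 3).1 - (Q 2).1) * ((Q 1).1 - (Q 2).1) + ((Q 3).2 - (Q 2).2) * ((Q 1).2 - (Q 2).2) = 0
    rw [e1, e2]
    exact ⟨⟨by ring, by ring⟩, by linear_combination hd⟩
  · change ((Q 1).1 + (Q 3).1 = (Q 0).1 + (Q 2).1 ∧ (Q 1).2 + (Q 3).2 = (Q 0).2 + (Q 2).2) ∧
      ((Q 0).1 - (Q 3).1) * ((Q 2).1 - (Q 3).1) + ((Q 0).2 - (Q 3).2) * ((Q 2).2 - (Q 3).2) = 0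
    rw [e1, e2]
    exact ⟨⟨by ring, by ring⟩, by linear_combination -hd⟩

/-- Perpendiculars to parallel vectors are parallel. -/
theorem parallel_of_perp_of_parallel {u v u' v' : Pt} (hu : u ≠ 0) (hu' : u' ≠ 0)
    (huv : u.1 * v.1 + u.2 * v.2 = 0) (huv' : u'.1 * v'.1 + u'.2 * v'.2 = 0)
    (h : u.1 * u'.2 - u.2 * u'.1 = 0) : v.1 * v'.2 - v.2 * v'.1 = 0 := by
  have hpos : ∀ w : Pt, w ≠ 0 → w.1 ^ 2 + w.2 ^ 2 ≠ 0 := by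
    intro w hw h0
    have h1 : w.1 = 0 := by nlinarith [sq_nonneg w.1, sq_nonneg w.2]
    have h2 : w.2 = 0 := by nlinarith [sq_nonneg w.1, sq_nonneg w.2]
    exact hw (Prod.ext h1 h2)
  have key : ∀ u v : Pt, u.1 * v.1 + u.2 * v.2 = 0 →
      (u.1 ^ 2 + u.2 ^ 2) * v.1 = -u.2 * (u.1 * v.2 - u.2 * v.1) ∧
      (u.1 ^ 2 + u.2 ^ 2) * v.2 = u.1 * (u.1 * v.2 - u.2 * v.1) := fun u v h =>
    ⟨by linear_combination u.1 * h, by linear_combination u.2 * h⟩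
  obtain ⟨h1, h2⟩ := key u v huv
  obtain ⟨h3, h4⟩ := key u' v' huv'
  have : ((u.1 ^ 2 + u.2 ^ 2) * (u'.1 ^ 2 + u'.2 ^ 2)) * (v.1 * v'.2 - v.2 * v'.1) = 0 := by
    calc _ = ((u.1 ^ 2 + u.2 ^ 2) * v.1) * ((u'.1 ^ 2 + u'.2 ^ 2) * v'.2) -
          ((u.1 ^ 2 + u.2 ^ 2) * v.2) * ((u'.1 ^ 2 + u'.2 ^ 2) * v'.1) := by ring
      _ = 0 := by
        rw [h1, h2, h3, h4]
        linear_combination (u.1 * v.2 - u.2 * v.1) * (u'.1 * v'.2 - u'.2 * v'.1) * h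
  exact (mul_eq_zero.1 this).resolve_left (mul_ne_zero (hpos u hu) (hpos u' hu'))

theorem finite_QZeroJA (S : ℕ → Finset Pt) (j a : Fin 4 → ℕ) : (QZeroJA S j a).Finite := by
  refine (Set.Finite.pi' fun k : Fin 4 => (S (j k)).finite_toSet).subset ?_
  intro Q hQ k
  exact hQ.2.2.1 k

theorem cyclic_adj_symm : ∀ {k s : Fin 4}, s = k + 1 ∨ s = k - 1 → k = s + 1 ∨ k = s - 1 := by
  decide

theorem cyclic_adj_ne : ∀ {k s : Fin 4}, s = k + 1 ∨ s = k - 1 → s ≠ k := by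
  decide

theorem cyclic_adj_or_opposite :
    ∀ {k s : Fin 4}, s ≠ k → (s = k + 1 ∨ s = k - 1) ∨ s = k + 2 := by
  decide

/-- A vertex confined to one of its side lines takes few values. -/
theorem card_image_vertex_le {S : ℕ → Finset Pt} {j a : Fin 4 → ℕ} {R : Finset Quad}
    (hR : ∀ Q ∈ R, Q ∈ QZeroJA S j a) {u w : Fin 4} (hw : w = u + 1 ∨ w = u - 1)
    (h : ∀ Q ∈ R, ∀ Q' ∈ R, crossProd (Q u) (Q w) (Q' u) = 0) :
    (R.image fun Q => Q u).card ≤ 2 ^ (a u + 1) := by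
  rcases R.eq_empty_or_nonempty with rfl | ⟨Q, hQ⟩
  · simp
  obtain ⟨-, hinj, -, hmax⟩ := hR Q hQ
  have hne : Q u ≠ Q w := hinj.ne (cyclic_adj_ne hw).symm
  have hlt : lineCount (lineThrough (Q u) (Q w)) (S (j u)) < 2 ^ (a u + 1) := by
    have := (hmax u).2
    rw [max_lt_iff] at this
    rcases hw with rfl | rfl
    · exact this.1
    · exact this.2
  rw [lineCount_lineThrough hne] at hlt
  refine (Finset.card_le_card fun p hp => ?_).trans hlt.le
  obtain ⟨Q', hQ', rfl⟩ := Finset.mem_image.1 hp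
  exact Finset.mem_filter.2 ⟨(hR Q' hQ').2.2.1 u, h Q hQ Q' hQ'⟩

/-- Three vertices of a rectangle determine it. -/
theorem IsPara.eq_of_three {Q Q' : Quad} (hQ : IsPara Q) (hQ' : IsPara Q') {k u v : Fin 4}
    (huk : u ≠ k) (hvk : v ≠ k) (huv : u ≠ v) (h1 : Q k = Q' k) (h2 : Q u = Q' u)
    (h3 : Q v = Q' v) : Q = Q' := by
  obtain ⟨w, hw⟩ : ∃ w : Fin 4, ∀ i, i = w ∨ i = k ∨ i = u ∨ i = v := by
    clear h1 h2 h3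
    revert k u v
    decide
  have hne : ∀ i, i ≠ w → Q i = Q' i := fun i hi => by
    rcases (hw i).resolve_left hi with rfl | rfl | rfl <;> assumption
  have hwQ : Q w = Q' w := by
    rw [IsPara] at hQ hQ'
    fin_cases w
    · rw [hne 1 (by decide), hne 2 (by decide), hne 3 (by decide), ← hQ'] at hQ
      exact add_right_cancel hQ
    · rw [hne 0 (by decide), hne 2 (by decide), hne 3 (by decide), hQ'] at hQ
      exact (add_right_cancel hQ).symm
    · rw [hne 0 (by decide), hne 1 (by decide), hne 3 (by decide), ← hQ'] at hQ
      exact add_left_cancel hQ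
    · rw [hne 0 (by decide), hne 1 (by decide), hne 2 (by decide), hQ'] at hQ
      exact (add_left_cancel hQ).symm
  funext i
  by_cases hi : i = w
  · rw [hi, hwQ]
  · exact hne i hi

/-- Rectangles with a common corner and parallel sides are determined by any two of the other
vertices, each of which is confined to a side line. -/
theorem card_le_of_common_corner {S : ℕ → Finset Pt} {j a : Fin 4 → ℕ} {R : Finset Quad}
    (hR : ∀ Q ∈ R, Q ∈ QZeroJA S j a) {k : Fin 4} (hk : ∀ Q ∈ R, ∀ Q' ∈ R, Q k = Q' k)
    (h1 : ∀ Q ∈ R, ∀ Q' ∈ R, crossProd (Q k) (Q (k + 1)) (Q' (k + 1)) = 0)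
    (h2 : ∀ Q ∈ R, ∀ Q' ∈ R, crossProd (Q k) (Q (k - 1)) (Q' (k - 1)) = 0)
    {u v : Fin 4} (huk : u ≠ k) (hvk : v ≠ k) (huv : u ≠ v) :
    R.card ≤ 2 ^ (a u + 1) * 2 ^ (a v + 1) := by
  classical
  have main : ∀ u v : Fin 4, u = k + 1 ∨ u = k - 1 → v ≠ k → u ≠ v →
      R.card ≤ 2 ^ (a u + 1) * 2 ^ (a v + 1) := by
    clear! u v
    intro u v hu hvk huv
    have huk : u ≠ k := cyclic_adj_ne hu
    have hu0 : ∀ Q ∈ R, ∀ Q' ∈ R, crossProd (Q k) (Q u) (Q' u) = 0 := by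
      rcases hu with rfl | rfl
      · exact h1
      · exact h2
    have himg : (R.image fun Q => Q u).card ≤ 2 ^ (a u + 1) := by
      refine card_image_vertex_le hR (cyclic_adj_symm hu) fun Q hQ Q' hQ' => ?_
      have := hu0 Q hQ Q' hQ'
      simp only [crossProd] at this ⊢
      linear_combination -this
    have hfib : R.card ≤ 2 ^ (a v + 1) * (R.image fun Q => Q u).card := by
      refine Finset.card_le_mul_card_image R _ fun p _ => ?_
      set F := R.filter fun Q => Q u = p with hF
      have hFR : ∀ Q ∈ F, Q ∈ R := fun Q hQ => (Finset.mem_filter.1 hQ).1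
      have hFu : ∀ Q ∈ F, ∀ Q' ∈ F, Q u = Q' u := fun Q hQ Q' hQ' =>
        (Finset.mem_filter.1 hQ).2.trans (Finset.mem_filter.1 hQ').2.symm
      have hinj : Set.InjOn (fun Q : Quad => Q v) F := fun Q hQ Q' hQ' h =>
        (hR Q (hFR Q hQ)).1.1.eq_of_three (hR Q' (hFR Q' hQ')).1.1 huk hvk huv
          (hk Q (hFR Q hQ) Q' (hFR Q' hQ')) (hFu Q hQ Q' hQ') h
      rw [← Finset.card_image_of_injOn hinj]
      have hFQ : ∀ Q ∈ F, Q ∈ QZeroJA S j a := fun Q hQ => hR Q (hFR Q hQ)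
      rcases cyclic_adj_or_opposite hvk with hv | rfl
      · refine card_image_vertex_le hFQ (cyclic_adj_symm hv) fun Q hQ Q' hQ' => ?_
        have : crossProd (Q k) (Q v) (Q' v) = 0 := by
          rcases hv with rfl | rfl
          · exact h1 Q (hFR Q hQ) Q' (hFR Q' hQ')
          · exact h2 Q (hFR Q hQ) Q' (hFR Q' hQ')
        simp only [crossProd] at this ⊢
        linear_combination -this
      · refine card_image_vertex_le hFQ (w := u) ?_ fun Q hQ Q' hQ' => ?_
        · clear * - hu
          revert k u
          decide
        · have r1 := ((hFQ Q hQ).1.at_vertex k).1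
          have r2 := ((hFQ Q' hQ').1.at_vertex k).1
          have e1 := hFu Q hQ Q' hQ'
          have e2 := hk Q (hFR Q hQ) Q' (hFR Q' hQ')
          have c1 := h1 Q (hFR Q hQ) Q' (hFR Q' hQ')
          have c2 := h2 Q (hFR Q hQ) Q' (hFR Q' hQ')
          have d1 : Q (k + 2) = Q (k + 1) + Q (k - 1) - Q k := by rw [← r1]; ring
          have d2 : Q' (k + 2) = Q' (k + 1) + Q' (k - 1) - Q' k := by rw [← r2]; ring
          simp only [crossProd] at c1 c2
          rw [d1, d2]
          rcases hu with rfl | rfl <;> rw [← e1, ← e2] <;>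
            simp only [crossProd, Prod.fst_add, Prod.snd_add, Prod.fst_sub, Prod.snd_sub]
          · linear_combination -c2
          · linear_combination -c1
    calc R.card ≤ 2 ^ (a v + 1) * (R.image fun Q => Q u).card := hfib
      _ ≤ 2 ^ (a v + 1) * 2 ^ (a u + 1) := Nat.mul_le_mul_left _ himg
      _ = _ := mul_comm _ _
  by_cases hu : u = k + 1 ∨ u = k - 1
  · exact main u v hu hvk huv
  · have hv : v = k + 1 ∨ v = k - 1 := by
      rcases cyclic_adj_or_opposite hvk with hv | hv
      · exact hv
      · exact absurd (((cyclic_adj_or_opposite huk).resolve_left hu).trans hv.symm) huv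
    rw [mul_comm]
    exact main v u hv huk huv.symm

/-- Rectangles of `QZeroJA` whose side from the `k`-th to the `s`-th vertex is rich. -/
theorem card_rich_side_mul_le {S : ℕ → Finset Pt} {j a : Fin 4 → ℕ} {R : Finset Quad}
    (hR : ∀ Q ∈ R, Q ∈ QZeroJA S j a) {k s : Fin 4} (hs : s = k + 1 ∨ s = k - 1)
    (hrich : ∀ Q ∈ R, 2 ^ a k ≤ lineCount (lineThrough (Q k) (Q s)) (S (j k)))
    (ha : 1 ≤ a k) {N K : ℝ} (hN : 0 < N) (hS : (S (j k)).card ≤ N)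
    (hK : ((2 : ℝ) ^ a k) ^ 2 ≤ K * N) {u v : Fin 4} (huk : u ≠ k) (hvk : v ≠ k) (huv : u ≠ v) :
    (R.card : ℝ) * (2 ^ a k) ^ 2 ≤ 8 * (1024 + 16 * K) * (2 ^ a u * 2 ^ a v) * N ^ 2 := by
  classical
  have hne : ∀ Q ∈ R, ∀ i, i ≠ k → Q k ≠ Q i := fun Q hQ i hi => (hR Q hQ).2.1.ne hi.symm
  have hsk : s ≠ k := cyclic_adj_ne hs
  set key : Quad → Pt × (ℝ × ℝ) := fun Q => (Q k, shearLine (Q k) (Q s)) with hkey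
  have hI := card_rich_incidences_mul_le (S (j k)) (R.image key) (2 ^ a k)
    (by simpa using Nat.pow_le_pow_right (n := 2) (by norm_num) ha) (fun x hx => ?_) hN hS
    (by exact_mod_cast hK)
  · have hfib : R.card ≤ 2 ^ (a u + 1) * 2 ^ (a v + 1) * (R.image key).card := by
      refine Finset.card_le_mul_card_image R _ fun x _ => ?_
      have hF : ∀ Q ∈ R.filter fun Q => key Q = x, Q ∈ R ∧ key Q = x := fun Q hQ =>
        Finset.mem_filter.1 hQ
      have hk : ∀ Q ∈ R.filter fun Q => key Q = x, ∀ Q' ∈ R.filter fun Q => key Q = x,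
          Q k = Q' k := fun Q hQ Q' hQ' =>
        congrArg Prod.fst ((hF Q hQ).2.trans (hF Q' hQ').2.symm)
      have hs0 : ∀ Q ∈ R.filter fun Q => key Q = x, ∀ Q' ∈ R.filter fun Q => key Q = x,
          crossProd (Q k) (Q s) (Q' s) = 0 := by
        intro Q hQ Q' hQ'
        have h : shearLine (Q k) (Q s) = shearLine (Q' k) (Q' s) :=
          congrArg Prod.snd ((hF Q hQ).2.trans (hF Q' hQ').2.symm)
        rw [← onLine_shearLine (hne Q (hF Q hQ).1 s hsk), h,
          onLine_shearLine (hne Q' (hF Q' hQ').1 s hsk), crossProd_self_right]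
      have hperp : ∀ t, (s = k + 1 ∧ t = k - 1) ∨ (s = k - 1 ∧ t = k + 1) →
          ∀ Q ∈ R.filter fun Q => key Q = x, ∀ Q' ∈ R.filter fun Q => key Q = x,
          crossProd (Q k) (Q t) (Q' t) = 0 := by
        intro t ht Q hQ Q' hQ'
        have hdot : ∀ Q ∈ R, (Q s - Q k).1 * (Q t - Q k).1 + (Q s - Q k).2 * (Q t - Q k).2 = 0 := by
          intro Q hQ
          have := ((hR Q hQ).1.at_vertex k).2
          rcases ht with ⟨rfl, rfl⟩ | ⟨rfl, rfl⟩
          · exact this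
          · simp only [Prod.fst_sub, Prod.snd_sub]
            linear_combination this
        have hkk := hk Q hQ Q' hQ'
        have h0 := hs0 Q hQ Q' hQ'
        have := parallel_of_perp_of_parallel
          (sub_ne_zero.2 (hne Q (hF Q hQ).1 s hsk).symm)
          (sub_ne_zero.2 (hne Q' (hF Q' hQ').1 s hsk).symm) (hdot Q (hF Q hQ).1)
          (hdot Q' (hF Q' hQ').1) (by rw [← hkk]; exact h0)
        rw [← hkk] at this
        exact this
      refine card_le_of_common_corner (fun Q hQ => hR Q (hF Q hQ).1) hk ?_ ?_ huk hvk huv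
      · rcases hs with h | h
        · exact h ▸ hs0
        · exact hperp _ (Or.inr ⟨h, rfl⟩)
      · rcases hs with h | h
        · exact hperp _ (Or.inl ⟨h, rfl⟩)
        · exact h ▸ hs0
    have hfib' : (R.card : ℝ) ≤ 2 ^ (a u + 1) * 2 ^ (a v + 1) * ((R.image key).card : ℝ) := by
      exact_mod_cast hfib
    push_cast at hI
    calc (R.card : ℝ) * (2 ^ a k) ^ 2
        ≤ 2 ^ (a u + 1) * 2 ^ (a v + 1) * ((R.image key).card : ℝ) * (2 ^ a k) ^ 2 := by gcongr
      _ = 2 ^ (a u + 1) * 2 ^ (a v + 1) * (((R.image key).card : ℝ) * (2 ^ a k) ^ 2) := by ring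
      _ ≤ 2 ^ (a u + 1) * 2 ^ (a v + 1) * (2 * (1024 + 16 * K) * N ^ 2) := by gcongr
      _ = _ := by ring
  · obtain ⟨Q, hQ, rfl⟩ := Finset.mem_image.1 hx
    have hQs := hne Q hQ s hsk
    have hcount : (S (j k)).filter (fun p => OnLine (shearLine (Q k) (Q s)) (shear p)) =
        (S (j k)).filter fun p => crossProd (Q k) (Q s) p = 0 :=
      Finset.filter_congr fun p _ => onLine_shearLine hQs p
    have h1 := hrich Q hQ
    have h2 : lineCount (lineThrough (Q k) (Q s)) (S (j k)) < 2 ^ (a k + 1) := by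
      have := ((hR Q hQ).2.2.2 k).2
      rw [max_lt_iff] at this
      rcases hs with rfl | rfl
      · exact this.1
      · exact this.2
    rw [lineCount_lineThrough hQs] at h1 h2
    refine ⟨(hR Q hQ).2.2.1 k, ?_, ?_⟩
    · rw [onLine_shearLine hQs]
      exact crossProd_self_left _ _
    · rw [pow_succ, mul_comm] at h2
      simp only [hkey]
      convert And.intro h1 h2

/-- The basic counting bound, for a corner `k` and any two of the other vertices. -/
theorem ncard_QZeroJA_mul_le {S : ℕ → Finset Pt} {j a : Fin 4 → ℕ} {k : Fin 4}
    (ha : 1 ≤ a k) {N K : ℝ} (hN : 0 < N) (hS : (S (j k)).card ≤ N)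
    (hK : ((2 : ℝ) ^ a k) ^ 2 ≤ K * N) {u v : Fin 4} (huk : u ≠ k) (hvk : v ≠ k) (huv : u ≠ v) :
    ((QZeroJA S j a).ncard : ℝ) * (2 ^ a k) ^ 2 ≤
      16 * (1024 + 16 * K) * (2 ^ a u * 2 ^ a v) * N ^ 2 := by
  classical
  set R := (finite_QZeroJA S j a).toFinset with hRdef
  have hR : ∀ Q ∈ R, Q ∈ QZeroJA S j a := fun Q hQ => (finite_QZeroJA S j a).mem_toFinset.1 hQ
  set side : Fin 4 → Finset Quad := fun s =>
    R.filter fun Q => 2 ^ a k ≤ lineCount (lineThrough (Q k) (Q s)) (S (j k)) with hside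
  have hbound : ∀ s, s = k + 1 ∨ s = k - 1 → ((side s).card : ℝ) * (2 ^ a k) ^ 2 ≤
      8 * (1024 + 16 * K) * (2 ^ a u * 2 ^ a v) * N ^ 2 := fun s hs =>
    card_rich_side_mul_le (fun Q hQ => hR Q (Finset.mem_filter.1 hQ).1) hs
      (fun Q hQ => (Finset.mem_filter.1 hQ).2) ha hN hS hK huk hvk huv
  have hcover : R ⊆ side (k + 1) ∪ side (k - 1) := by
    intro Q hQ
    have := ((hR Q hQ).2.2.2 k).1
    rw [le_max_iff] at this
    rw [Finset.mem_union]
    exact this.imp (fun h => Finset.mem_filter.2 ⟨hQ, h⟩) fun h => Finset.mem_filter.2 ⟨hQ, h⟩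
  have hcard : (R.card : ℝ) ≤ (side (k + 1)).card + (side (k - 1)).card := by
    exact_mod_cast (Finset.card_le_card hcover).trans (Finset.card_union_le _ _)
  rw [Set.ncard_eq_toFinset_card _ (finite_QZeroJA S j a), ← hRdef]
  have h := mul_le_mul_of_nonneg_right hcard (sq_nonneg ((2 : ℝ) ^ a k))
  linarith [hbound (k + 1) (Or.inl rfl), hbound (k - 1) (Or.inr rfl)]

/-- Interpolation between the corner estimates. -/
theorem interpolate_corner_bounds {T κ : ℝ} {j a : Fin 4 → ℝ}
    (h : ∀ k u v, u ≠ k → v ≠ k → u ≠ v → T + 2 * a k ≤ κ + (a u + a v) + 2 * j k) :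
    T ≤ κ + ((∑ k, j k) / 2 - (1 / 10000) *
      ∑ k, (|j k - j (k + 1)| + |a k - a (k + 1)|)) := by
  obtain ⟨p, hp⟩ := Finite.exists_max a
  obtain ⟨q, hq⟩ := Finite.exists_min a
  obtain ⟨s, hs⟩ := Finite.exists_max j
  obtain ⟨t, ht⟩ := Finite.exists_min j
  have hgain : 4 * T ≤ 4 * κ + 2 * ∑ k, j k - (a p - a q) := by
    have e1 := h 0 1 2 (by decide) (by decide) (by decide)
    have e2 := h 0 1 3 (by decide) (by decide) (by decide)
    have e3 := h 0 2 3 (by decide) (by decide) (by decide)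
    have e4 := h 1 0 2 (by decide) (by decide) (by decide)
    have e5 := h 1 0 3 (by decide) (by decide) (by decide)
    have e6 := h 1 2 3 (by decide) (by decide) (by decide)
    have e7 := h 2 0 1 (by decide) (by decide) (by decide)
    have e8 := h 2 0 3 (by decide) (by decide) (by decide)
    have e9 := h 2 1 3 (by decide) (by decide) (by decide)
    have e10 := h 3 0 1 (by decide) (by decide) (by decide)
    have e11 := h 3 0 2 (by decide) (by decide) (by decide)
    have e12 := h 3 1 2 (by decide) (by decide) (by decide)
    have p0 := hp 0
    have p1 := hp 1
    have p2 := hp 2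
    have p3 := hp 3
    rw [Fin.sum_univ_four]
    clear hp hq hs ht h
    fin_cases p <;> fin_cases q <;> simp only [Fin.zero_eta, Fin.mk_one, Fin.reduceFinMk] at * <;>
      linarith
  have hlow : T ≤ κ + 2 * j t + 2 * (a p - a q) := by
    have := h t (t + 1) (t - 1) (cyclic_adj_ne (Or.inl rfl)) (cyclic_adj_ne (Or.inr rfl))
      (by clear * -; revert t; decide)
    linarith [hp (t + 1), hp (t - 1), hq t]
  have hsum : 3 * j t + j s ≤ ∑ k, j k := by
    have := Finset.card_nsmul_le_sum (Finset.univ.erase s) j (j t) fun k _ => ht k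
    rw [Finset.card_erase_of_mem (Finset.mem_univ s)] at this
    norm_num at this
    linarith
  have hosc : ∑ k, (|j k - j (k + 1)| + |a k - a (k + 1)|) ≤
      4 * ((j s - j t) + (a p - a q)) := by
    have := Finset.sum_le_card_nsmul Finset.univ
      (fun k => |j k - j (k + 1)| + |a k - a (k + 1)|) ((j s - j t) + (a p - a q)) fun k _ =>
        add_le_add (abs_le.2 ⟨by linarith [ht k, hs (k + 1)], by linarith [hs k, ht (k + 1)]⟩)
          (abs_le.2 ⟨by linarith [hq k, hp (k + 1)], by linarith [hp k, hq (k + 1)]⟩)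
    simpa [mul_add] using this
  have := hp q
  have := hs t
  linarith

/-- **Interpolated counting bound (Case II of Lemma 3.3), with `δ = 1/10000`.**
If `1 ≤ a_k < j_k/2 + C` for all `k`, then
`#𝒬⁰(j⃗,a⃗) ≲ 2^{(j₁+j₂+j₃+j₄)/2 − δ Σ_k (|j_k − j_{k+1}| + |a_k − a_{k+1}|)}`. -/
theorem QZeroJA_interpolated_count (C : ℕ) :
    ∃ c : ℝ, 0 < c ∧
      ∀ (m : ℕ) (S : ℕ → Finset Pt),
        1 ≤ m →
        (∀ i ≤ m, ∀ j ≤ m, i ≠ j → Disjoint (S i) (S j)) →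
        (∀ j ≤ m, (S j).card ≤ 2 ^ j) →
        ∀ j a : Fin 4 → ℕ, (∀ k, j k ≤ m) →
          (∀ k, 1 ≤ a k ∧ (a k : ℝ) < (j k : ℝ) / 2 + (C : ℝ)) →
          ((QZeroJA S j a).ncard : ℝ) ≤
            c * (2 : ℝ) ^ ((∑ k : Fin 4, (j k : ℝ)) / 2 -
              (1 / 10000) * ∑ k : Fin 4,
                (|(j k : ℝ) - (j (k + 1) : ℝ)| + |(a k : ℝ) - (a (k + 1) : ℝ)|)) := by
  obtain ⟨M, hMC⟩ : ∃ M : ℝ, M = 16 * (1024 + 16 * 4 ^ C) := ⟨_, rfl⟩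
  have hM : 0 < M := by rw [hMC]; positivity
  refine ⟨M, hM, fun m S _ _ hS j a hj ha => ?_⟩
  rcases Nat.eq_zero_or_pos (QZeroJA S j a).ncard with h0 | hpos
  · rw [h0, Nat.cast_zero]
    positivity
  have hpos' : (0 : ℝ) < (QZeroJA S j a).ncard := by exact_mod_cast hpos
  have key := interpolate_corner_bounds (T := Real.logb 2 (QZeroJA S j a).ncard)
    (κ := Real.logb 2 M) (j := fun k => (j k : ℝ))
    (a := fun k => (a k : ℝ)) fun k u v huk hvk huv => ?_
  · rw [Real.logb_le_iff_le_rpow one_lt_two hpos', Real.rpow_add two_pos,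
      Real.rpow_logb two_pos (by norm_num) hM] at key
    exact key
  · have hK : ((2 : ℝ) ^ a k) ^ 2 ≤ 4 ^ C * 2 ^ j k := by
      have h : a k * 2 ≤ 2 * C + j k := by
        have : (a k : ℝ) * 2 ≤ 2 * C + j k := by linarith [(ha k).2]
        exact_mod_cast this
      calc ((2 : ℝ) ^ a k) ^ 2 = 2 ^ (a k * 2) := (pow_mul _ _ _).symm
        _ ≤ 2 ^ (2 * C + j k) := pow_le_pow_right₀ one_le_two h
        _ = 4 ^ C * 2 ^ j k := by rw [pow_add, pow_mul]; norm_num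
    have hcount := ncard_QZeroJA_mul_le (S := S) (j := j) (ha k).1 (N := 2 ^ j k) (by positivity)
      (by exact_mod_cast hS (j k) (hj k)) hK huk hvk huv
    rw [← hMC] at hcount
    have hlog := Real.logb_le_logb_of_le one_lt_two (by positivity) hcount
    have h2 : ∀ n : ℕ, Real.logb 2 ((2 : ℝ) ^ n) = n := fun n => by
      rw [Real.logb_pow, Real.logb_self_eq_one one_lt_two, mul_one]
    rw [Real.logb_mul hpos'.ne' (by positivity), Real.logb_mul (by positivity) (by positivity),
      Real.logb_mul hM.ne' (by positivity), Real.logb_mul (by positivity) (by positivity),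
      Real.logb_pow _ ((2 : ℝ) ^ a k), Real.logb_pow _ ((2 : ℝ) ^ j k), h2, h2, h2, h2] at hlog
    push_cast at hlog
    linarith
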